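/- arXiv:2605.12094 — 3 statements merged into one kernel-verified Lean document; each statement's English description precedes it below -/
import Mathlib

section
/- Let Ω be a finite nonempty type, r ∈ (0,1], u : Ω → ℝ, and μ a probability vector on Ω. Define F_μ(b) := b − (1/r) · Σ_ω μ(ω) · max(b − u(ω), 0) for b ∈ ℝ. Then sup_{b ∈ ℝ} F_μ(b) = max_{ω' ∈ Ω} F_μ(u(ω')); that is, the supremum over all real b is attained at some b in the finite set of utility values {u(ω') : ω' ∈ Ω}. -/
open Finset

/-- If no value of `u` lies strictly between `b` and `x`, then the CVaR objective is affine between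
them, with slope determined by the mass of `{u ≤ b}`. -/
theorem cvar_objective_eq_add_slope_mul {Ω : Type*} [Fintype Ω] (r : ℝ) (u μ : Ω → ℝ) {b x : ℝ}
    (hle : ∀ ω, u ω ≤ b → u ω ≤ x) (hlt : ∀ ω, b < u ω → x ≤ u ω) :
    x - (1 / r) * ∑ ω, μ ω * max (x - u ω) 0
      = b - (1 / r) * ∑ ω, μ ω * max (b - u ω) 0
        + (x - b) * (1 - (1 / r) * ∑ ω with u ω ≤ b, μ ω) := by
  have key : ∑ ω, μ ω * max (x - u ω) 0
      = ∑ ω, μ ω * max (b - u ω) 0 + (x - b) * ∑ ω with u ω ≤ b, μ ω := by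
    rw [Finset.sum_filter, Finset.mul_sum, ← Finset.sum_add_distrib]
    refine Finset.sum_congr rfl fun ω _ => ?_
    by_cases h : u ω ≤ b
    · rw [if_pos h, max_eq_left (sub_nonneg.2 (hle ω h)), max_eq_left (sub_nonneg.2 h)]
      ring
    · have h' := not_le.1 h
      rw [if_neg h, max_eq_right (sub_nonpos.2 (hlt ω h')), max_eq_right (sub_nonpos.2 h'.le)]
      ring
  rw [key]
  ring

/-- Every value of the CVaR objective is dominated by its value at some utility value. -/
theorem exists_cvar_objective_le {Ω : Type*} [Fintype Ω] {r : ℝ} (hr : r ∈ Set.Ioc (0 : ℝ) 1)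
    (u μ : Ω → ℝ) (hμ1 : ∑ ω, μ ω = 1) (b : ℝ) :
    ∃ ω', b - (1 / r) * ∑ ω, μ ω * max (b - u ω) 0
      ≤ u ω' - (1 / r) * ∑ ω, μ ω * max (u ω' - u ω) 0 := by
  obtain ⟨hr0, hr1⟩ := hr
  rcases le_or_gt (1 - (1 / r) * ∑ ω with u ω ≤ b, μ ω) 0 with hs | hs
  · have hne : (univ.filter fun ω => u ω ≤ b).Nonempty := by
      by_contra h
      rw [Finset.not_nonempty_iff_eq_empty.1 h] at hs
      norm_num at hs
    obtain ⟨ω', hmem, hmax⟩ := Finset.exists_max_image _ u hne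
    have hω' : u ω' ≤ b := (Finset.mem_filter.1 hmem).2
    refine ⟨ω', ?_⟩
    rw [cvar_objective_eq_add_slope_mul r u μ (b := b) (x := u ω')
      (fun ω h => hmax ω (by simpa using h)) (fun ω h => hω'.trans h.le)]
    exact le_add_of_nonneg_right (mul_nonneg_of_nonpos_of_nonpos (sub_nonpos.2 hω') hs)
  · have hne : (univ.filter fun ω => b < u ω).Nonempty := by
      by_contra! h
      have hall : ∀ ω, u ω ≤ b := by simpa [Finset.filter_eq_empty_iff] using h
      rw [Finset.filter_true_of_mem fun ω _ => hall ω, hμ1, mul_one] at hs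
      linarith [(one_le_div hr0).2 hr1]
    obtain ⟨ω', hmem, hmin⟩ := Finset.exists_min_image _ u hne
    have hω' : b < u ω' := (Finset.mem_filter.1 hmem).2
    refine ⟨ω', ?_⟩
    rw [cvar_objective_eq_add_slope_mul r u μ (b := b) (x := u ω')
      (fun ω h => h.trans hω'.le) (fun ω h => hmin ω (by simpa using h))]
    exact le_add_of_nonneg_right (mul_nonneg (sub_nonneg.2 hω'.le) hs.le)

/-- **The CVaR supremum is attained at a utility value.**
For a finite nonempty `Ω`, `r ∈ (0,1]`, utility `u` and probability vector `μ`, with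
`F_μ(b) := b − (1/r) · Σ_ω μ(ω) · max (b − u(ω)) 0`, the supremum of `F_μ` over all of `ℝ`
equals the maximum of `F_μ` over the finite set of utility values `{u ω' : ω' ∈ Ω}`,
i.e. it is attained at some `b = u ω'`. -/
theorem cvar_sup_attained_at_utility_values
    (Ω : Type*) [Fintype Ω] [Nonempty Ω]
    (r : ℝ) (hr : r ∈ Set.Ioc (0 : ℝ) 1)
    (u : Ω → ℝ) (μ : Ω → ℝ)
    (hμ0 : ∀ ω, 0 ≤ μ ω) (hμ1 : ∑ ω, μ ω = 1) :
    sSup (Set.range fun b : ℝ => b - (1 / r) * ∑ ω, μ ω * max (b - u ω) 0)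
      = Finset.univ.sup' Finset.univ_nonempty
          (fun ω' : Ω => u ω' - (1 / r) * ∑ ω, μ ω * max (u ω' - u ω) 0) ∧
    IsGreatest (Set.range fun b : ℝ => b - (1 / r) * ∑ ω, μ ω * max (b - u ω) 0)
      (Finset.univ.sup' Finset.univ_nonempty
        (fun ω' : Ω => u ω' - (1 / r) * ∑ ω, μ ω * max (u ω' - u ω) 0)) := by
  have hgreatest :
      IsGreatest (Set.range fun b : ℝ => b - (1 / r) * ∑ ω, μ ω * max (b - u ω) 0)
        (Finset.univ.sup' Finset.univ_nonempty
          (fun ω' : Ω => u ω' - (1 / r) * ∑ ω, μ ω * max (u ω' - u ω) 0)) := by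
    constructor
    · obtain ⟨ω', -, h⟩ := Finset.exists_mem_eq_sup' Finset.univ_nonempty
        (fun ω' : Ω => u ω' - (1 / r) * ∑ ω, μ ω * max (u ω' - u ω) 0)
      exact ⟨u ω', h.symm⟩
    · rintro _ ⟨b, rfl⟩
      obtain ⟨ω', h⟩ := exists_cvar_objective_le hr u μ hμ1 b
      exact h.trans (Finset.le_sup'
        (fun ω' : Ω => u ω' - (1 / r) * ∑ ω, μ ω * max (u ω' - u ω) 0) (Finset.mem_univ ω'))
  exact ⟨hgreatest.csSup_eq, hgreatest⟩
end

section
/- Let Ω be a finite state space, μ0 a prior with μ0(ω) > 0 for all ω, A a finite nonempty action set, ρ a max-affine risk value with index sets L_a and coefficients c_{a,ℓ}, and v : Ω × A → ℝ a sender payoff. For every incentive-compatible signaling scheme (S, π, α) with finite signal set S, there exists an active-facet LP solution q whose objective value equals the sender value of the scheme. Consequently, the supremum of the LP objective over all active-facet LP solutions equals the supremum of sender values over all incentive-compatible signaling schemes with finitely many signals. -/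
open Finset

variable {Ω A S : Type*}

/-- A signaling scheme: nonnegative signal probabilities summing to one in each state. -/
def IsScheme [Fintype S] (π : Ω → S → ℝ) : Prop :=
  (∀ ω s, 0 ≤ π ω s) ∧ ∀ ω, ∑ s, π ω s = 1

/-- Unconditional probability of signal `s` under prior `μ0` and scheme `π`. -/
def sigProb [Fintype Ω] (μ0 : Ω → ℝ) (π : Ω → S → ℝ) (s : S) : ℝ :=
  ∑ ω, μ0 ω * π ω s

/-- Posterior belief after observing signal `s` (defined when `sigProb μ0 π s > 0`). -/
noncomputable def posterior [Fintype Ω] (μ0 : Ω → ℝ) (π : Ω → S → ℝ) (s : S) (ω : Ω) : ℝ :=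
  μ0 ω * π ω s / sigProb μ0 π s

/-- Incentive compatibility. -/
def IC [Fintype Ω] (ρ : (Ω → ℝ) → A → ℝ) (μ0 : Ω → ℝ) (π : Ω → S → ℝ) (α : S → A) : Prop :=
  ∀ s, 0 < sigProb μ0 π s → ∀ a' : A, ρ (posterior μ0 π s) a' ≤ ρ (posterior μ0 π s) (α s)

/-- Sender's expected value of a scheme. -/
def senderValue [Fintype Ω] [Fintype S] (μ0 : Ω → ℝ) (π : Ω → S → ℝ) (α : S → A)
    (v : Ω → A → ℝ) : ℝ :=
  ∑ ω, ∑ s, μ0 ω * π ω s * v ω (α s)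

/-- The receiver's max-affine risk value. -/
noncomputable def maxAffine [Fintype Ω] {L : A → Type*} [∀ a, Fintype (L a)]
    [∀ a, Nonempty (L a)] (c : (a : A) → L a → Ω → ℝ) (μ : Ω → ℝ) (a : A) : ℝ :=
  Finset.univ.sup' Finset.univ_nonempty fun ℓ : L a => ∑ ω, c a ℓ ω * μ ω

/-- Feasibility for the active-facet LP. -/
def LPFeasible [Fintype Ω] [Fintype A] {L : A → Type*} [∀ a, Fintype (L a)]
    (c : (a : A) → L a → Ω → ℝ) (μ0 : Ω → ℝ) (q : (Σ a : A, L a) → Ω → ℝ) : Prop :=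
  (∀ σ ω, 0 ≤ q σ ω) ∧
  (∀ ω, ∑ σ : Σ a : A, L a, q σ ω = μ0 ω) ∧
  (∀ σ σ' : Σ a : A, L a, 0 ≤ ∑ ω, q σ ω * (c σ.1 σ.2 ω - c σ'.1 σ'.2 ω))

/-- Objective value of the active-facet LP. -/
def LPValue [Fintype Ω] [Fintype A] {L : A → Type*} [∀ a, Fintype (L a)]
    (v : Ω → A → ℝ) (q : (Σ a : A, L a) → Ω → ℝ) : ℝ :=
  ∑ σ : Σ a : A, L a, ∑ ω, q σ ω * v ω σ.1

theorem sum_mul_posterior [Fintype Ω] (f μ0 : Ω → ℝ) (π : Ω → S → ℝ) (s : S) :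
    ∑ ω, f ω * posterior μ0 π s ω = (∑ ω, f ω * (μ0 ω * π ω s)) / sigProb μ0 π s := by
  simp only [posterior, Finset.sum_div, mul_div_assoc]

/-- Incentive compatibility for a max-affine risk value means that at every signal some facet of
the recommended action dominates all facets, with the joint weights `μ0 ω * π ω s` in place of
the posterior. -/
theorem ic_maxAffine_iff [Fintype Ω] {L : A → Type*} [∀ a, Fintype (L a)] [∀ a, Nonempty (L a)]
    (c : (a : A) → L a → Ω → ℝ) {μ0 : Ω → ℝ} {π : Ω → S → ℝ} (α : S → A)
    (hnonneg : ∀ ω s, 0 ≤ μ0 ω * π ω s) :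
    IC (maxAffine c) μ0 π α ↔ ∀ s, ∃ ℓ : L (α s), ∀ σ' : Σ a, L a,
      ∑ ω, c σ'.1 σ'.2 ω * (μ0 ω * π ω s) ≤ ∑ ω, c (α s) ℓ ω * (μ0 ω * π ω s) := by
  constructor
  · intro h s
    obtain ⟨ℓ, -, hℓ⟩ := Finset.exists_mem_eq_sup' (Finset.univ_nonempty (α := L (α s)))
      fun ℓ => ∑ ω, c (α s) ℓ ω * posterior μ0 π s ω
    refine ⟨ℓ, fun σ' => ?_⟩
    rcases (Finset.sum_nonneg fun ω _ => hnonneg ω s).eq_or_lt with h0 | hpos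
    · have hzero := (Finset.sum_eq_zero_iff_of_nonneg fun ω _ => hnonneg ω s).1 h0.symm
      simp [fun ω => hzero ω (Finset.mem_univ ω)]
    · have hle := (Finset.le_sup' (fun ℓ' => ∑ ω, c σ'.1 ℓ' ω * posterior μ0 π s ω)
        (Finset.mem_univ σ'.2)).trans ((h s hpos σ'.1).trans_eq hℓ)
      simp only [sum_mul_posterior] at hle
      exact (div_le_div_iff_of_pos_right hpos).1 hle
  · intro h s hpos a'
    obtain ⟨ℓ, hℓ⟩ := h s
    refine Finset.sup'_le _ _ fun ℓ' _ => le_trans ?_ (Finset.le_sup' _ (Finset.mem_univ ℓ))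
    simp only [sum_mul_posterior]
    exact (div_le_div_iff_of_pos_right hpos).2 (hℓ ⟨a', ℓ'⟩)

theorem exists_lpFeasible_of_ic [Fintype Ω] [Fintype A] [Fintype S]
    {L : A → Type*} [∀ a, Fintype (L a)] [∀ a, Nonempty (L a)]
    (c : (a : A) → L a → Ω → ℝ) {μ0 : Ω → ℝ} (hμ0 : ∀ ω, 0 ≤ μ0 ω) (v : Ω → A → ℝ)
    {π : Ω → S → ℝ} {α : S → A} (hπ : IsScheme π) (hIC : IC (maxAffine c) μ0 π α) :
    ∃ q : (Σ a : A, L a) → Ω → ℝ, LPFeasible c μ0 q ∧ LPValue v q = senderValue μ0 π α v := by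
  classical
  have hnonneg : ∀ ω s, 0 ≤ μ0 ω * π ω s := fun ω s => mul_nonneg (hμ0 ω) (hπ.1 ω s)
  choose ℓ hℓ using (ic_maxAffine_iff c α hnonneg).1 hIC
  let facet : S → Σ a, L a := fun s => ⟨α s, ℓ s⟩
  refine ⟨fun σ ω => ∑ s with facet s = σ, μ0 ω * π ω s,
    ⟨fun σ ω => Finset.sum_nonneg fun s _ => hnonneg ω s, fun ω => ?_, fun σ σ' => ?_⟩, ?_⟩
  · rw [Finset.sum_fiberwise, ← Finset.mul_sum, hπ.2, mul_one]
  · simp only [Finset.sum_mul]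
    rw [Finset.sum_comm]
    refine Finset.sum_nonneg fun s hs => ?_
    obtain rfl := (Finset.mem_filter.1 hs).2
    simp only [mul_comm (μ0 _ * π _ s), sub_mul, Finset.sum_sub_distrib, sub_nonneg]
    exact hℓ s σ'
  · simp only [LPValue, senderValue]
    rw [Finset.sum_comm]
    refine Finset.sum_congr rfl fun ω _ => ?_
    rw [← Finset.sum_fiberwise _ facet]
    refine Finset.sum_congr rfl fun σ _ => ?_
    rw [Finset.sum_mul]
    refine Finset.sum_congr rfl fun s hs => ?_
    obtain rfl := (Finset.mem_filter.1 hs).2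
    rfl

theorem exists_ic_of_lpFeasible [Fintype Ω] [Fintype A]
    {L : A → Type*} [∀ a, Fintype (L a)] [∀ a, Nonempty (L a)]
    {c : (a : A) → L a → Ω → ℝ} {μ0 : Ω → ℝ} (hμ0 : ∀ ω, 0 < μ0 ω) (v : Ω → A → ℝ)
    {q : (Σ a : A, L a) → Ω → ℝ} (hq : LPFeasible c μ0 q) :
    ∃ (n : ℕ) (π : Ω → Fin n → ℝ) (α : Fin n → A),
      IsScheme π ∧ IC (maxAffine c) μ0 π α ∧ senderValue μ0 π α v = LPValue v q := by
  obtain ⟨hnonneg, hplaus, hdom⟩ := hq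
  let e := Fintype.equivFin (Σ a : A, L a)
  have hjoint : ∀ ω i, μ0 ω * (q (e.symm i) ω / μ0 ω) = q (e.symm i) ω := fun ω i =>
    mul_div_cancel₀ _ (hμ0 ω).ne'
  refine ⟨_, fun ω i => q (e.symm i) ω / μ0 ω, fun i => (e.symm i).1,
    ⟨fun ω i => div_nonneg (hnonneg _ _) (hμ0 ω).le, fun ω => ?_⟩, ?_, ?_⟩
  · rw [← Finset.sum_div, e.symm.sum_comp fun σ => q σ ω, hplaus, div_self (hμ0 ω).ne']
  · refine (ic_maxAffine_iff c _ fun ω i => ?_).2 fun i => ⟨(e.symm i).2, fun σ' => ?_⟩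
    · rw [hjoint]
      exact hnonneg _ _
    · have := hdom (e.symm i) σ'
      simp only [mul_sub, Finset.sum_sub_distrib, sub_nonneg] at this
      simpa only [hjoint, mul_comm] using this
  · simp only [senderValue, LPValue, hjoint]
    rw [Finset.sum_comm]
    exact e.symm.sum_comp fun σ => ∑ ω, q σ ω * v ω σ.1

/-- **Completeness of the active-facet LP and exactness of its value.** Every
incentive-compatible signaling scheme with a finite signal set yields a feasible
active-facet LP solution with the same objective value; consequently the supremum of the
LP objective over feasible solutions equals the supremum of sender values over all
incentive-compatible signaling schemes with finitely many signals. -/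
theorem active_facet_lp_completeness
    (Ω A : Type*) [Fintype Ω] [Fintype A] [Nonempty A]
    (L : A → Type*) [∀ a, Fintype (L a)] [∀ a, Nonempty (L a)]
    (c : (a : A) → L a → Ω → ℝ)
    (μ0 : Ω → ℝ) (hμ0pos : ∀ ω, 0 < μ0 ω) (hμ0sum : ∑ ω, μ0 ω = 1)
    (v : Ω → A → ℝ) :
    (∀ (S : Type) [Fintype S] (π : Ω → S → ℝ) (α : S → A),
      IsScheme π → IC (maxAffine c) μ0 π α →
      ∃ q : (Σ a : A, L a) → Ω → ℝ,
        LPFeasible c μ0 q ∧ LPValue v q = senderValue μ0 π α v) ∧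
    sSup {x : ℝ | ∃ q : (Σ a : A, L a) → Ω → ℝ, LPFeasible c μ0 q ∧ x = LPValue v q}
      = sSup {x : ℝ | ∃ (n : ℕ) (π : Ω → Fin n → ℝ) (α : Fin n → A),
          IsScheme π ∧ IC (maxAffine c) μ0 π α ∧ x = senderValue μ0 π α v} := by
  refine ⟨fun S _ π α hπ hIC => exists_lpFeasible_of_ic c (fun ω => (hμ0pos ω).le) v hπ hIC,
    congrArg sSup (Set.ext fun x => ⟨?_, ?_⟩)⟩
  · rintro ⟨q, hq, rfl⟩
    obtain ⟨n, π, α, hπ, hIC, h⟩ := exists_ic_of_lpFeasible hμ0pos v hq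
    exact ⟨n, π, α, hπ, hIC, h.symm⟩
  · rintro ⟨n, π, α, hπ, hIC, rfl⟩
    obtain ⟨q, hq, h⟩ := exists_lpFeasible_of_ic c (fun ω => (hμ0pos ω).le) v hπ hIC
    exact ⟨q, hq, h.symm⟩
end

section
/- Assume the finite-statistic representation with statistics g_1,…,g_D bounded by |g_j(ω)| ≤ C_g, Lipschitz constant L_Ψ > 0, B_ρ := C_g·L_Ψ, finite action set A, tolerance ε_R > 0, and prior μ0 with μ0(ω) > 0 for all ω. Let (S, π, α) be an exactly incentive-compatible signaling scheme with finite signal set S and sender value OPT (for sender payoff v : Ω × A → ℝ). If k ≥ (2B_ρ²/ε_R²)·log(2D), then there exists φ : Ω × Σ̂ → ℝ that is feasible for the state-contingent LP (φ ≥ 0; Σ_{σ∈Σ̂} φ(ω,σ) = 1 for each ω; and for every σ = (μ̄_σ,a_σ) ∈ Σ̂ and j, Σ_ω μ0(ω)φ(ω,σ)(g_j(ω) − ⟨g_j,μ̄_σ⟩ + ε_R/L_Ψ) ≥ 0 and Σ_ω μ0(ω)φ(ω,σ)(g_j(ω) − ⟨g_j,μ̄_σ⟩ − ε_R/L_Ψ)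 ≤ 0) whose objective value Σ_ω μ0(ω) Σ_{σ∈Σ̂} φ(ω,σ) v(ω,a_σ) equals OPT. -/
open Finset

variable {Ω A S : Type*}

/-- A probability vector on a finite type. -/
def IsProbVec {Ω : Type*} [Fintype Ω] (μ : Ω → ℝ) : Prop :=
  (∀ ω, 0 ≤ μ ω) ∧ ∑ ω, μ ω = 1

/-- A `k`-uniform vector: every coordinate lies in `{0, 1/k, 2/k, …, 1}`. -/
def IsKUniform {Ω : Type*} (k : ℕ) (μ : Ω → ℝ) : Prop :=
  ∀ ω, ∃ j : ℕ, j ≤ k ∧ μ ω = (j : ℝ) / k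

/-- **Hoeffding's lemma** for a probability vector on a finite type. -/
lemma IsProbVec.sum_mul_exp_le {Ω : Type*} [Fintype Ω] {μ : Ω → ℝ} (hμ : IsProbVec μ)
    {f : Ω → ℝ} {C : ℝ} (hf : ∀ ω, |f ω| ≤ C) (t : ℝ) :
    ∑ ω, μ ω * Real.exp (t * (f ω - ∑ ω', f ω' * μ ω')) ≤ Real.exp (C ^ 2 * t ^ 2 / 2) := by
  let _ : MeasurableSpace Ω := ⊤
  have : DiscreteMeasurableSpace Ω := ⟨fun _ => trivial⟩
  let p : PMF Ω := PMF.ofFintype (fun ω => ENNReal.ofReal (μ ω)) (by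
    rw [← ENNReal.ofReal_sum_of_nonneg fun ω _ => hμ.1 ω, hμ.2, ENNReal.ofReal_one])
  have hp (F : Ω → ℝ) : ∫ ω, F ω ∂p.toMeasure = ∑ ω, μ ω * F ω := by
    rw [PMF.integral_eq_sum]
    refine Finset.sum_congr rfl fun ω _ => ?_
    simp only [p, PMF.ofFintype_apply, ENNReal.toReal_ofReal (hμ.1 ω), smul_eq_mul]
  have h := (ProbabilityTheory.hasSubgaussianMGF_of_mem_Icc (μ := p.toMeasure) (X := f)
    (a := -C) (b := C) (measurable_of_finite f).aemeasurable
    (.of_forall fun ω => abs_le.mp (hf ω))).mgf_le t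
  rw [ProbabilityTheory.mgf, hp, hp] at h
  simp only [mul_comm (f _)]
  refine h.trans_eq ?_
  simp only [NNReal.coe_pow, NNReal.coe_div, coe_nnnorm, Real.norm_eq_abs, div_pow, sq_abs,
    NNReal.coe_ofNat]
  ring_nf

/-- Some point has value at most the average. -/
lemma IsProbVec.exists_le_sum {Ω : Type*} [Fintype Ω] [Nonempty Ω] {μ : Ω → ℝ}
    (hμ : IsProbVec μ) (F : Ω → ℝ) : ∃ ω, F ω ≤ ∑ ω', μ ω' * F ω' := by
  obtain ⟨ω, hω⟩ := Finite.exists_min F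
  refine ⟨ω, ?_⟩
  calc F ω = ∑ ω', μ ω' * F ω := by rw [← Finset.sum_mul, hμ.2, one_mul]
    _ ≤ _ := Finset.sum_le_sum fun ω' _ => mul_le_mul_of_nonneg_left (hω ω') (hμ.1 ω')

/-- The method of conditional expectations: some multiset of `n` sample points keeps a sum of
exponential potentials below its expected value. -/
lemma IsProbVec.exists_counts_sum_exp_le {Ω ι : Type*} [Fintype Ω] [Nonempty Ω] [Fintype ι]
    {μ : Ω → ℝ} (hμ : IsProbVec μ) (h : ι → Ω → ℝ) {K : ℝ}
    (hK : ∀ i, ∑ ω, μ ω * Real.exp (h i ω) ≤ K) (n : ℕ) :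
    ∃ c : Ω → ℕ, ∑ ω, c ω = n ∧
      ∑ i, Real.exp (∑ ω, c ω * h i ω) ≤ Fintype.card ι * K ^ n := by
  classical
  induction n with
  | zero => exact ⟨0, by simp, by simp⟩
  | succ n ih =>
    obtain ⟨c, hc, hcK⟩ := ih
    obtain ⟨ω₀, hω₀⟩ := hμ.exists_le_sum
      fun ω₀ => ∑ i, Real.exp (∑ ω, c ω * h i ω) * Real.exp (h i ω₀)
    refine ⟨c + Pi.single ω₀ 1, by simp [Finset.sum_add_distrib, hc], ?_⟩
    have hsum (i : ι) : ∑ ω, ((c + Pi.single ω₀ 1 : Ω → ℕ) ω : ℝ) * h i ω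
        = ∑ ω, c ω * h i ω + h i ω₀ := by
      simp [add_mul, Finset.sum_add_distrib, Pi.single_apply]
    obtain _ | hι := isEmpty_or_nonempty ι
    · simp
    have hK0 : 0 ≤ K := (Finset.sum_nonneg fun ω _ =>
      mul_nonneg (hμ.1 ω) (Real.exp_pos _).le).trans (hK hι.some)
    calc _ = ∑ i, Real.exp (∑ ω, c ω * h i ω) * Real.exp (h i ω₀) := by
            simp only [hsum, Real.exp_add]
      _ ≤ _ := hω₀
      _ = ∑ i, Real.exp (∑ ω, c ω * h i ω) * ∑ ω, μ ω * Real.exp (h i ω) := by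
            simp only [Finset.mul_sum]
            rw [Finset.sum_comm]
            exact Finset.sum_congr rfl fun _ _ => Finset.sum_congr rfl fun _ _ => by ring
      _ ≤ ∑ i, Real.exp (∑ ω, c ω * h i ω) * K := Finset.sum_le_sum fun i _ =>
            mul_le_mul_of_nonneg_left (hK i) (Real.exp_pos _).le
      _ ≤ Fintype.card ι * K ^ n * K := by
            rw [← Finset.sum_mul]
            exact mul_le_mul_of_nonneg_right hcK hK0
      _ = _ := by ring

/-- Normalized counts form a probability vector. -/
lemma isProbVec_counts_div {Ω : Type*} [Fintype Ω] {k : ℕ} (hk : 1 ≤ k) {c : Ω → ℕ}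
    (hc : ∑ ω, c ω = k) : IsProbVec fun ω => (c ω : ℝ) / k := by
  have hk' : (k : ℝ) ≠ 0 := by positivity
  refine ⟨fun ω => by positivity, ?_⟩
  rw [← Finset.sum_div, ← Nat.cast_sum, hc, div_self hk']

/-- Normalized counts are `k`-uniform. -/
lemma isKUniform_counts_div {Ω : Type*} [Fintype Ω] {k : ℕ} {c : Ω → ℕ}
    (hc : ∑ ω, c ω = k) : IsKUniform k fun ω => (c ω : ℝ) / k := fun ω =>
  ⟨c ω, hc ▸ Finset.single_le_sum (fun _ _ => Nat.zero_le _) (Finset.mem_univ ω), rfl⟩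

/-- Sampling `k ≥ (2 C² / δ²) log (2 D)` points approximates `D` statistics bounded by `C`
simultaneously up to `δ`. -/
lemma IsProbVec.exists_isKUniform_abs_sub_le {Ω : Type*} [Fintype Ω] [Nonempty Ω]
    {μ : Ω → ℝ} (hμ : IsProbVec μ) {D : ℕ} (g : Fin D → Ω → ℝ) {C δ : ℝ}
    (hg : ∀ j ω, |g j ω| ≤ C) (hδ : 0 < δ) {k : ℕ} (hk1 : 1 ≤ k)
    (hk : 2 * C ^ 2 / δ ^ 2 * Real.log (2 * D) ≤ k) :
    ∃ ν : Ω → ℝ, IsProbVec ν ∧ IsKUniform k ν ∧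
      ∀ j, |∑ ω, g j ω * ν ω - ∑ ω, g j ω * μ ω| ≤ δ := by
  set t : ℝ := δ / C ^ 2 with ht
  set m : Fin D → ℝ := fun j => ∑ ω, g j ω * μ ω with hm
  let h : Fin D × Bool → Ω → ℝ := fun i ω => (bif i.2 then t else -t) * (g i.1 ω - m i.1)
  obtain ⟨c, hc, hcK⟩ := hμ.exists_counts_sum_exp_le h (K := Real.exp (C ^ 2 * t ^ 2 / 2)) (by
    rintro ⟨j, b⟩
    cases b
    · simpa [h, hm] using hμ.sum_mul_exp_le (hg j) (-t)
    · simpa [h, hm] using hμ.sum_mul_exp_le (hg j) t) k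
  have hk0 : (0 : ℝ) < k := by exact_mod_cast hk1
  refine ⟨_, isProbVec_counts_div hk1 hc, isKUniform_counts_div hc, fun j => ?_⟩
  change |_ - m j| ≤ δ
  have hC0 : 0 ≤ C := (abs_nonneg _).trans (hg j (Classical.arbitrary Ω))
  obtain hC | hC := hC0.eq_or_lt
  · have hg0 : ∀ ω, g j ω = 0 := fun ω => abs_nonpos_iff.mp (hC ▸ hg j ω)
    simpa [hm, hg0] using hδ.le
  have hD : (0 : ℝ) < D := by exact_mod_cast j.pos
  have hbound (b : Bool) : ∑ ω, c ω * h (j, b) ω ≤ k * (δ * t) := by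
    have h1 : Real.exp (∑ ω, c ω * h (j, b) ω) ≤ _ :=
      (Finset.single_le_sum (f := fun i => Real.exp (∑ ω, c ω * h i ω))
        (fun _ _ => (Real.exp_pos _).le) (Finset.mem_univ (j, b))).trans hcK
    have h2 : ((Fintype.card (Fin D × Bool) : ℕ) : ℝ) = Real.exp (Real.log (2 * D)) := by
      rw [Real.exp_log (by positivity)]
      simp [mul_comm]
    rw [h2, ← Real.exp_nat_mul, ← Real.exp_add, Real.exp_le_exp] at h1
    have h3 : Real.log (2 * D) ≤ k * (δ ^ 2 / (2 * C ^ 2)) := by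
      calc Real.log (2 * D)
          = 2 * C ^ 2 / δ ^ 2 * Real.log (2 * D) * (δ ^ 2 / (2 * C ^ 2)) := by field_simp
        _ ≤ _ := mul_le_mul_of_nonneg_right hk (by positivity)
    calc _ ≤ _ := h1
      _ ≤ k * (δ ^ 2 / (2 * C ^ 2)) + k * (C ^ 2 * t ^ 2 / 2) := by gcongr
      _ = _ := by rw [ht]; field_simp; ring
  have hsum : ∑ ω, (c ω : ℝ) * (g j ω - m j) = k * (∑ ω, g j ω * (c ω / k) - m j) := by
    rw [mul_sub, Finset.mul_sum]
    simp only [mul_sub, Finset.sum_sub_distrib, ← Finset.sum_mul]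
    rw [← Nat.cast_sum, hc]
    congr 1
    exact Finset.sum_congr rfl fun _ _ => by field_simp
  have ht0 : 0 < k * t := by positivity
  have hT := hbound true
  have hF := hbound false
  simp only [h, cond_true, cond_false, mul_left_comm (c _ : ℝ), ← Finset.mul_sum, hsum] at hT hF
  rw [abs_le]
  constructor
  · refine le_of_mul_le_mul_left ?_ ht0
    linarith
  · refine le_of_mul_le_mul_left ?_ ht0
    linarith

/-- **Completeness of the state-contingent LP.** Under the finite-statistic representation
with statistics bounded by `C_g`, `L_Ψ`-Lipschitz (ℓ∞) maps `Ψ_a` and `B_ρ = C_g·L_Ψ`,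
if `k ≥ (2B_ρ²/ε_R²)·log(2D)`, then for every exactly incentive-compatible finite
signaling scheme with sender value `OPT` there is a state-contingent LP feasible solution
`φ`, supported on approximate-center signals `(cen σ, act σ) ∈ Σ̂` (with `k`-uniform
probability centers at which the recommended action is `2ε_R`-optimal), whose objective
value equals `OPT`. -/
theorem state_contingent_lp_completeness
    (Ω A : Type*) [Fintype Ω] [Nonempty Ω] [Fintype A] [Nonempty A]
    (D : ℕ) (hD : 1 ≤ D) (g : Fin D → Ω → ℝ)
    (Cg : ℝ) (hCg : ∀ j ω, |g j ω| ≤ Cg)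
    (LΨ : ℝ) (hLΨ : 0 < LΨ)
    (Ψ : A → (Fin D → ℝ) → ℝ) (hLip : ∀ a, LipschitzWith LΨ.toNNReal (Ψ a))
    (ρ : (Ω → ℝ) → A → ℝ)
    (hρ : ∀ (ν : Ω → ℝ) (a : A), ρ ν a = Ψ a fun j => ∑ ω, g j ω * ν ω)
    (εR : ℝ) (hεR : 0 < εR)
    (μ0 : Ω → ℝ) (hμ0pos : ∀ ω, 0 < μ0 ω) (hμ0sum : ∑ ω, μ0 ω = 1)
    (v : Ω → A → ℝ)
    (S : Type*) [Fintype S] (π : Ω → S → ℝ) (α : S → A)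
    (hπ : IsScheme π) (hIC : IC ρ μ0 π α)
    (k : ℕ) (hk1 : 1 ≤ k)
    (hk : 2 * (Cg * LΨ) ^ 2 / εR ^ 2 * Real.log (2 * D) ≤ (k : ℝ)) :
    ∃ (M : ℕ) (cen : Fin M → Ω → ℝ) (act : Fin M → A) (φ : Ω → Fin M → ℝ),
      (∀ σ, IsProbVec (cen σ)) ∧ (∀ σ, IsKUniform k (cen σ)) ∧
      (∀ (σ : Fin M) (a' : A), ρ (cen σ) a' - 2 * εR ≤ ρ (cen σ) (act σ)) ∧
      (∀ ω σ, 0 ≤ φ ω σ) ∧ (∀ ω, ∑ σ, φ ω σ = 1) ∧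
      (∀ (σ : Fin M) (j : Fin D),
        0 ≤ ∑ ω, μ0 ω * φ ω σ * (g j ω - (∑ ω', g j ω' * cen σ ω') + εR / LΨ)) ∧
      (∀ (σ : Fin M) (j : Fin D),
        ∑ ω, μ0 ω * φ ω σ * (g j ω - (∑ ω', g j ω' * cen σ ω') - εR / LΨ) ≤ 0) ∧
      ∑ ω, μ0 ω * ∑ σ, φ ω σ * v ω (act σ) = senderValue μ0 π α v := by
  have hδ : 0 < εR / LΨ := by positivity
  have hk' : 2 * Cg ^ 2 / (εR / LΨ) ^ 2 * Real.log (2 * D) ≤ k := by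
    refine le_of_eq_of_le ?_ hk
    field_simp
  have key (s : S) : ∃ (ν : Ω → ℝ) (a : A), IsProbVec ν ∧ IsKUniform k ν ∧
      (∀ a', ρ ν a' - 2 * εR ≤ ρ ν a) ∧
      (∀ j, 0 ≤ ∑ ω, μ0 ω * π ω s * (g j ω - (∑ ω', g j ω' * ν ω') + εR / LΨ)) ∧
      (∀ j, ∑ ω, μ0 ω * π ω s * (g j ω - (∑ ω', g j ω' * ν ω') - εR / LΨ) ≤ 0) ∧
      ∀ ω, π ω s * v ω a = π ω s * v ω (α s) := by
    have hnn (ω : Ω) : 0 ≤ μ0 ω * π ω s := mul_nonneg (hμ0pos ω).le (hπ.1 ω s)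
    obtain hs | hs := (Finset.sum_nonneg fun ω _ => hnn ω : 0 ≤ sigProb μ0 π s).eq_or_lt
    · have hπ0 (ω : Ω) : π ω s = 0 := by
        have := (Finset.sum_eq_zero_iff_of_nonneg fun ω _ => hnn ω).mp hs.symm ω
          (Finset.mem_univ ω)
        exact (mul_eq_zero.mp this).resolve_left (hμ0pos ω).ne'
      obtain ⟨ν, hν, hνk, -⟩ := IsProbVec.exists_isKUniform_abs_sub_le
        ⟨fun ω => (hμ0pos ω).le, hμ0sum⟩ g hCg hδ hk1 hk'
      obtain ⟨a, ha⟩ := Finite.exists_max (ρ ν)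
      exact ⟨ν, a, hν, hνk, fun a' => by linarith [ha a'], by simp [hπ0], by simp [hπ0],
        by simp [hπ0]⟩
    · change 0 < sigProb μ0 π s at hs
      have hpost : IsProbVec (posterior μ0 π s) := by
        refine ⟨fun ω => div_nonneg (hnn ω) hs.le, ?_⟩
        simp only [posterior]
        rw [← Finset.sum_div]
        exact div_self hs.ne'
      obtain ⟨ν, hν, hνk, happ⟩ := hpost.exists_isKUniform_abs_sub_le g hCg hδ hk1 hk'
      have hdist (a : A) : |ρ ν a - ρ (posterior μ0 π s) a| ≤ εR := by
        rw [hρ, hρ, ← Real.dist_eq]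
        refine ((hLip a).dist_le_mul _ _).trans ?_
        rw [Real.coe_toNNReal _ hLΨ.le]
        calc _ ≤ LΨ * (εR / LΨ) := mul_le_mul_of_nonneg_left
              ((dist_pi_le_iff hδ.le).mpr fun j => by rw [Real.dist_eq]; exact happ j) hLΨ.le
          _ = εR := by field_simp
      have hsum (j : Fin D) (x : ℝ) : ∑ ω, μ0 ω * π ω s * (g j ω - (∑ ω', g j ω' * ν ω') + x)
          = sigProb μ0 π s *
            (∑ ω, g j ω * posterior μ0 π s ω - (∑ ω', g j ω' * ν ω') + x) := by
        have hmean : ∑ ω, μ0 ω * π ω s * g j ω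
            = sigProb μ0 π s * ∑ ω, g j ω * posterior μ0 π s ω := by
          rw [Finset.mul_sum]
          refine Finset.sum_congr rfl fun ω _ => ?_
          rw [posterior]
          field_simp
        simp only [mul_add, mul_sub, Finset.sum_add_distrib, Finset.sum_sub_distrib,
          ← Finset.sum_mul, hmean]
        rfl
      refine ⟨ν, α s, hν, hνk, fun a' => ?_, fun j => ?_, fun j => ?_, fun _ => rfl⟩
      · linarith [hIC s hs a', (abs_le.mp (hdist a')).2, (abs_le.mp (hdist (α s))).1]
      · rw [hsum]
        exact mul_nonneg hs.le (by linarith [(abs_le.mp (happ j)).2])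
      · simp only [sub_eq_add_neg _ (εR / LΨ)]
        rw [hsum]
        exact mul_nonpos_of_nonneg_of_nonpos hs.le (by linarith [(abs_le.mp (happ j)).1])
  choose ν a hν hνk hopt hlo hhi hval using key
  let e := (Fintype.equivFin S).symm
  refine ⟨Fintype.card S, fun σ => ν (e σ), fun σ => a (e σ), fun ω σ => π ω (e σ),
    fun σ => hν _, fun σ => hνk _, fun σ => hopt _, fun ω σ => hπ.1 _ _, fun ω => ?_,
    fun σ => hlo _, fun σ => hhi _, ?_⟩
  · rw [e.sum_comp fun s => π ω s]
    exact hπ.2 ω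
  · refine Finset.sum_congr rfl fun ω _ => ?_
    rw [e.sum_comp fun s => π ω s * v ω (a s), Finset.mul_sum]
    exact Finset.sum_congr rfl fun s _ => by rw [hval, mul_assoc]
end
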